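/- arXiv:1912.02267 — 3 statements merged into one kernel-verified Lean document; each statement's English description precedes it below -/
import Mathlib

section
/- The sequence E(n) = n! · ((2n−3)!! + (2n−2)!!) / (3·(2n−1)!) satisfies E(n) · 2^n / √n → √π / 3 as n → ∞. -/
open Filter Real

/-- Wallis' formula in square-root form: `4 ^ n * (n !) ^ 2 / ((2 n)! √n) → √π`. -/
theorem tendsto_four_pow_mul_factorial_sq_div :
    Tendsto (fun n : ℕ =>
        (4 : ℝ) ^ n * (Nat.factorial n : ℝ) ^ 2 / (Nat.factorial (2 * n) : ℝ) / √(n : ℝ))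
      atTop (nhds √π) := by
  have hinv : Tendsto (fun n : ℕ => 2 + 1 / (n : ℝ)) atTop (nhds (2 + 0)) :=
    tendsto_const_nhds.add tendsto_one_div_atTop_nhds_zero_nat
  have hW := (Real.Wallis.tendsto_W_nhds_pi_div_two.mul hinv).sqrt
  rw [show π / 2 * (2 + 0) = π by ring] at hW
  refine hW.congr' ?_
  filter_upwards [eventually_gt_atTop 0] with n hn
  have hn' : (0 : ℝ) < n := Nat.cast_pos.mpr hn
  have hfac : (0 : ℝ) < Nat.factorial (2 * n) := Nat.cast_pos.mpr (Nat.factorial_pos _)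
  have hsq : Real.Wallis.W n * (2 + 1 / (n : ℝ)) =
      ((4 : ℝ) ^ n * (Nat.factorial n : ℝ) ^ 2 / (Nat.factorial (2 * n) : ℝ)) ^ 2 / n := by
    rw [Real.Wallis.W_eq_factorial_ratio,
      show (2 : ℝ) ^ (4 * n) = ((4 : ℝ) ^ n) ^ 2 by
        rw [pow_right_comm, pow_mul]; norm_num]
    field_simp
  rw [hsq, Real.sqrt_div (sq_nonneg _), Real.sqrt_sq (by positivity)]

/-- The genus-one sequence, split into its even and odd double factorial contributions. -/
theorem genus_one_volume_eq {n : ℕ} (hn : 0 < n) :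
    (Nat.factorial n : ℝ) *
        ((Nat.doubleFactorial (2 * n - 3) : ℝ) + (Nat.doubleFactorial (2 * n - 2) : ℝ)) /
          (3 * (Nat.factorial (2 * n - 1) : ℝ)) * 2 ^ n / √(n : ℝ) =
      (4 : ℝ) ^ n * (Nat.factorial n : ℝ) ^ 2 / (Nat.factorial (2 * n) : ℝ) / √(n : ℝ) / 3 +
        (n : ℝ) / ((2 * n - 1 : ℝ)) * (2 / 3) * (√(n : ℝ))⁻¹ := by
  obtain ⟨m, rfl⟩ : ∃ m, n = m + 1 := ⟨n - 1, by omega⟩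
  have hodd : Nat.factorial (2 * m + 1) =
      (2 * m + 1) * Nat.doubleFactorial (2 * m - 1) * (2 ^ m * Nat.factorial m) := by
    rw [Nat.factorial_eq_mul_doubleFactorial, Nat.doubleFactorial_add_one,
      Nat.doubleFactorial_two_mul]
  rw [show 2 * (m + 1) - 3 = 2 * m - 1 by omega, show 2 * (m + 1) - 2 = 2 * m by omega,
    show 2 * (m + 1) - 1 = 2 * m + 1 by omega, show 2 * (m + 1) = 2 * m + 1 + 1 by ring,
    Nat.factorial_succ (2 * m + 1), hodd, Nat.doubleFactorial_two_mul, Nat.factorial_succ m,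
    show (4 : ℝ) ^ (m + 1) = 2 ^ (m + 1) * 2 ^ (m + 1) by rw [← mul_pow]; norm_num]
  have hd : (0 : ℝ) < Nat.doubleFactorial (2 * m - 1) :=
    Nat.cast_pos.mpr (Nat.doubleFactorial_pos _)
  have hf : (0 : ℝ) < Nat.factorial m := Nat.cast_pos.mpr (Nat.factorial_pos _)
  have hs : (0 : ℝ) < √((m + 1 : ℕ) : ℝ) := Real.sqrt_pos.mpr (by positivity)
  have hsub : 2 * ((m + 1 : ℕ) : ℝ) - 1 = 2 * m + 1 := by push_cast; ring
  rw [hsub]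
  generalize √((m + 1 : ℕ) : ℝ) = s at *
  push_cast
  field_simp
  ring

/-- The sequence `E(n) = n! * ((2n-3)!! + (2n-2)!!) / (3 * (2n-1)!)` satisfies
`E(n) * 2^n / √n → √π / 3` as `n → ∞`. -/
theorem tendsto_genus_one_volume_asymptotic :
    Tendsto (fun n : ℕ =>
        (Nat.factorial n : ℝ) *
            ((Nat.doubleFactorial (2 * n - 3) : ℝ) + (Nat.doubleFactorial (2 * n - 2) : ℝ)) /
              (3 * (Nat.factorial (2 * n - 1) : ℝ)) * 2 ^ n / Real.sqrt n)
      atTop (nhds (Real.sqrt Real.pi / 3)) := by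
  have hratio : Tendsto (fun n : ℕ => (n : ℝ) / (2 * n - 1 : ℝ)) atTop (nhds (1 / (2 - 0))) := by
    refine (tendsto_const_nhds.div
      (tendsto_const_nhds.sub tendsto_one_div_atTop_nhds_zero_nat) (by norm_num)).congr' ?_
    filter_upwards [eventually_gt_atTop 0] with n hn
    have hn' : (n : ℝ) ≠ 0 := Nat.cast_ne_zero.mpr hn.ne'
    rw [Pi.div_apply, show (2 - 1 / n : ℝ) = (2 * n - 1) / n by field_simp, one_div_div]
  have hsqrt : Tendsto (fun n : ℕ => (√(n : ℝ))⁻¹) atTop (nhds 0) :=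
    tendsto_inv_atTop_zero.comp (Real.tendsto_sqrt_atTop.comp tendsto_natCast_atTop_atTop)
  have hlim := (tendsto_four_pow_mul_factorial_sq_div.div_const 3).add
    ((hratio.mul_const (2 / 3)).mul hsqrt)
  rw [mul_zero, add_zero] at hlim
  refine hlim.congr' ?_
  filter_upwards [eventually_gt_atTop 0] with n hn
  exact (genus_one_volume_eq hn).symm
end

section
/- There exist ε > 0 and a function s : ℝ → ℝ which is real-analytic at 0, with s(0) = 0 and s'(0) = −1, such that for all t in the open interval (−ε, ε) one has s(t) + log(1 − s(t)) = t + log(1 − t). Moreover s is locally unique in the following sense: if s̃ is any function on a neighborhood of 0 with s̃(0) = 0, differentiable at 0 with s̃'(0) = −1, and satisfying s̃(t) + log(1 − s̃(t)) = t + log(1 − t) near 0, then s̃ agrees with s on some neighborhood of 0. -/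
open Filter Real

/-- A real-analytic function with a nondegenerate critical point at `a` is, up to constants,
the square of a local analytic coordinate centred at `a`. -/
lemma AnalyticAt.exists_eventually_sub_eq_mul_sq {f : ℝ → ℝ} {a : ℝ} (hf : AnalyticAt ℝ f a)
    (h2 : analyticOrderAt (f · - f a) a = 2) :
    ∃ (c : ℝ) (u : ℝ → ℝ), c ≠ 0 ∧ AnalyticAt ℝ u a ∧ u a = 0 ∧ deriv u a ≠ 0 ∧
      ∀ᶠ t in nhds a, f t - f a = c * u t ^ 2 := by
  obtain ⟨h, hh, h0, hfac⟩ :=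
    ((hf.sub analyticAt_const).analyticOrderAt_eq_natCast (n := 2)).1 h2
  have hq : AnalyticAt ℝ (fun t ↦ h t / h a) a := hh.div analyticAt_const h0
  have hqa : h a / h a = 1 := div_self h0
  have hr : AnalyticAt ℝ (fun t ↦ √(h t / h a)) a :=
    (hq.contDiffAt.sqrt (by simp [hqa])).analyticAt
  have hu : HasDerivAt (fun t ↦ (t - a) * √(h t / h a)) 1 a := by
    simpa [hqa] using ((hasDerivAt_id a).sub_const a).fun_mul hr.differentiableAt.hasDerivAt
  refine ⟨h a, fun t ↦ (t - a) * √(h t / h a), h0, (analyticAt_id.sub analyticAt_const).mul hr,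
    by simp, by simp [hu.deriv], ?_⟩
  have hpos : ∀ᶠ t in nhds a, 0 < h t / h a :=
    hq.continuousAt.eventually_const_lt (by simp [hqa])
  filter_upwards [hfac, hpos] with t ht hpt
  rw [mul_pow, sq_sqrt hpt.le]
  simp only [Pi.sub_apply, smul_eq_mul] at ht
  rw [ht]
  field_simp

/-- Near a nondegenerate critical point `a`, a real-analytic function has a nontrivial local
deck transformation, and its germ at `a` is determined by its derivative `-1`. -/
lemma AnalyticAt.exists_deck_transformation {f : ℝ → ℝ} {a : ℝ} (hf : AnalyticAt ℝ f a)
    (h2 : analyticOrderAt (f · - f a) a = 2) :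
    ∃ s : ℝ → ℝ, AnalyticAt ℝ s a ∧ s a = a ∧ deriv s a = -1 ∧
      (∀ᶠ t in nhds a, f (s t) = f t) ∧
      ∀ g : ℝ → ℝ, g a = a → HasDerivAt g (-1) a → (∀ᶠ t in nhds a, f (g t) = f t) →
        g =ᶠ[nhds a] s := by
  obtain ⟨c, u, hc, hu, hua, hu', hfu⟩ := hf.exists_eventually_sub_eq_mul_sq h2
  have hd := hu.hasStrictDerivAt
  set r := hd.localInverse u _ a hu'
  have hra : AnalyticAt ℝ r (u a) := hu.analyticAt_localInverse hu'
  have hleft : ∀ᶠ t in nhds a, r (u t) = t := hd.eventually_left_inverse hu'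
  have hright : ∀ᶠ y in nhds (u a), u (r y) = y := hd.eventually_right_inverse hu'
  have hr' : HasDerivAt r (deriv u a)⁻¹ (u a) := (hd.to_localInverse hu').hasDerivAt
  have hneg : -u a = u a := by simp [hua]
  have hs : AnalyticAt ℝ (fun t ↦ r (-u t)) a :=
    AnalyticAt.fun_comp (by rwa [hneg]) hu.fun_neg
  have hsa : r (-u a) = a := by rw [hneg]; exact hleft.self_of_nhds
  have htend : Tendsto (fun t ↦ -u t) (nhds a) (nhds (u a)) := by
    simpa [hneg] using hu.continuousAt.fun_neg.tendsto
  have htends : Tendsto (fun t ↦ r (-u t)) (nhds a) (nhds a) := by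
    simpa [hsa] using hs.continuousAt.tendsto
  refine ⟨fun t ↦ r (-u t), hs, hsa, ?_, ?_, fun g hga hg hfg ↦ ?_⟩
  · have h : HasDerivAt (fun t ↦ r (-u t)) ((deriv u a)⁻¹ * -deriv u a) a :=
      HasDerivAt.comp a (h₂ := r) (by rwa [hneg]) hd.hasDerivAt.neg
    rw [h.deriv]
    field_simp
  · filter_upwards [hfu, htends.eventually hfu, htend.eventually hright] with t h₁ h₂ h₃
    rw [h₃, neg_sq, ← h₁] at h₂
    linarith
  · have htg : Tendsto g (nhds a) (nhds a) := by
      simpa [hga] using hg.continuousAt.tendsto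
    have hne : ∀ᶠ t in nhds a, t ≠ a → g t - t ≠ 0 :=
      eventually_nhdsWithin_iff.1
        ((hg.sub (hasDerivAt_id a)).eventually_ne (c := 0) (by norm_num))
    filter_upwards [hfu, htg.eventually hfu, hfg, hleft, htg.eventually hleft, hne]
      with t h₁ h₂ h₃ h₄ h₅ h₆
    have hsq : u (g t) ^ 2 = u t ^ 2 := mul_left_cancel₀ hc (by rw [← h₁, ← h₂, h₃])
    rcases sq_eq_sq_iff_eq_or_eq_neg.1 hsq with h | h
    · have hgt : g t = t := by rw [← h₅, h, h₄]
      have hta : t = a := by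
        by_contra hta
        exact h₆ hta (sub_eq_zero.2 hgt)
      rw [hta, hga, hsa]
    · rw [← h, h₅]

/-- The function `t ↦ t + log (1 - t)` has a nondegenerate critical point at `0`. -/
lemma analyticOrderAt_add_log_one_sub :
    analyticOrderAt (fun t : ℝ ↦ t + log (1 - t)) 0 = 2 := by
  have hf : AnalyticAt ℝ (fun t : ℝ ↦ t + log (1 - t)) 0 :=
    ContDiffAt.analyticAt (contDiffAt_id.add
      ((contDiffAt_const.sub contDiffAt_id).log (by norm_num)))
  have hderiv : deriv (fun t : ℝ ↦ t + log (1 - t)) =ᶠ[nhds 0] fun t ↦ 1 - (1 - t)⁻¹ := by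
    filter_upwards [eventually_lt_nhds (zero_lt_one' ℝ)] with t ht
    have h : HasDerivAt (fun t : ℝ ↦ t + log (1 - t)) (1 + -1 / (1 - t)) t :=
      (hasDerivAt_id t).add (((hasDerivAt_id t).const_sub 1).log (sub_pos.2 ht).ne')
    rw [h.deriv]
    ring
  have hd2 : HasDerivAt (fun t : ℝ ↦ 1 - (1 - t)⁻¹) (-1) 0 := by
    simpa using (((hasDerivAt_id (0 : ℝ)).const_sub 1).inv (by norm_num)).const_sub 1
  have h1 : analyticOrderAt (deriv fun t : ℝ ↦ t + log (1 - t)) 0 = 1 :=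
    hf.deriv.analyticOrderAt_eq_one_of_zero_deriv_ne_zero
      (by simp [hderiv.self_of_nhds]) (by simp [hderiv.deriv_eq, hd2.deriv])
  have h2 := hf.analyticOrderAt_deriv_add_one
  rw [h1] at h2
  simpa [one_add_one_eq_two] using h2.symm

/-- There exist `ε > 0` and a function `s : ℝ → ℝ`, real-analytic at `0`, with `s 0 = 0` and
`s' 0 = -1`, such that `s t + log (1 - s t) = t + log (1 - t)` for `t ∈ (-ε, ε)`; moreover
`s` is locally unique among functions `g` with `g 0 = 0`, differentiable at `0` with
derivative `-1`, satisfying the same functional equation near `0`. -/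
theorem exists_local_deck_transformation :
    ∃ (ε : ℝ) (s : ℝ → ℝ), 0 < ε ∧ AnalyticAt ℝ s 0 ∧ s 0 = 0 ∧ deriv s 0 = -1 ∧
      (∀ t ∈ Set.Ioo (-ε) ε, s t + Real.log (1 - s t) = t + Real.log (1 - t)) ∧
      ∀ g : ℝ → ℝ, g 0 = 0 → HasDerivAt g (-1) 0 →
        (∀ᶠ t in nhds (0 : ℝ), g t + Real.log (1 - g t) = t + Real.log (1 - t)) →
        g =ᶠ[nhds (0 : ℝ)] s := by
  have horder := analyticOrderAt_add_log_one_sub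
  have hf : AnalyticAt ℝ (fun t : ℝ ↦ t + log (1 - t)) 0 := by
    by_contra h
    simp [analyticOrderAt_of_not_analyticAt h] at horder
  obtain ⟨s, hs, hs0, hs', heq, huniq⟩ := hf.exists_deck_transformation (by simpa using horder)
  obtain ⟨ε, hε, hball⟩ := Metric.eventually_nhds_iff_ball.1 heq
  refine ⟨ε, s, hε, hs, hs0, hs', fun t ht ↦ hball t ?_, huniq⟩
  simpa [Real.ball_eq_Ioo] using ht
end

section
/- Define functions f_k : ℝ → ℝ recursively by f_0(t) = 1/t² and f_{k+1}(t) = −(d/dt)( f_k(t)·(1 − t)/t ). Then for every k ≥ 0 there exist integers c_{k,l} for k ≤ l ≤ 2k such that for all t ≠ 0 one has f_k(t) = Σ_{l=k}^{2k} c_{k,l} / t^{l+2}. -/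
/-- The operator `g ↦ -(g * (1 - t) / t)'` on the monomial `a / t ^ (l + 2)`. -/
theorem hasDerivAt_laurent_term (a : ℝ) (l : ℕ) {t : ℝ} (ht : t ≠ 0) :
    HasDerivAt (fun s : ℝ => a / s ^ (l + 2) * (1 - s) / s)
      (-((l + 3) * a / t ^ (l + 4) - (l + 2) * a / t ^ (l + 3))) t := by
  have hnum : HasDerivAt (fun s : ℝ => a * (1 - s)) (a * -1) t :=
    ((hasDerivAt_id t).const_sub 1).const_mul a
  have hquot := hnum.div (hasDerivAt_pow (l + 3) t) (pow_ne_zero _ ht)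
  refine (hquot.congr_deriv ?_).congr_of_eventuallyEq ?_
  · rw [show l + 3 - 1 = l + 2 by omega]
    push_cast
    field_simp
    ring
  · filter_upwards [isOpen_ne.mem_nhds ht] with s hs
    have hs' : s ≠ 0 := hs
    simp only [Pi.div_apply]
    field_simp
    ring

/-- Define `f_0 t = 1/t²` and `f_{k+1} t = -(d/dt)(f_k t * (1 - t)/t)`.  Then for every `k`
there exist integers `c_{k,l}` for `k ≤ l ≤ 2k` such that for all `t ≠ 0` one has
`f_k t = ∑_{l=k}^{2k} c_{k,l} / t^(l+2)`. -/
theorem xi_basis_laurent_structure (f : ℕ → ℝ → ℝ)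
    (h0 : ∀ t : ℝ, f 0 t = 1 / t ^ 2)
    (hrec : ∀ (k : ℕ) (t : ℝ), f (k + 1) t = -deriv (fun s : ℝ => f k s * (1 - s) / s) t) :
    ∀ k : ℕ, ∃ c : ℕ → ℤ, ∀ t : ℝ, t ≠ 0 →
      f k t = ∑ l ∈ Finset.Icc k (2 * k), (c l : ℝ) / t ^ (l + 2) := by
  intro k
  induction k with
  | zero => exact ⟨fun _ => 1, fun t _ => by simp [h0]⟩
  | succ k ih =>
    obtain ⟨c, hc⟩ := ih
    refine ⟨fun m => ∑ l ∈ Finset.Icc k (2 * k),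
      ((if m = l + 2 then (l + 3) * c l else 0) - (if m = l + 1 then (l + 2) * c l else 0)),
      fun t ht => ?_⟩
    have hderiv : HasDerivAt (fun s : ℝ => f k s * (1 - s) / s)
        (∑ l ∈ Finset.Icc k (2 * k),
          -((l + 3) * (c l : ℝ) / t ^ (l + 4) - (l + 2) * c l / t ^ (l + 3))) t := by
      refine (HasDerivAt.fun_sum fun l _ =>
        hasDerivAt_laurent_term (c l) l ht).congr_of_eventuallyEq ?_
      filter_upwards [isOpen_ne.mem_nhds ht] with s hs
      rw [hc s hs, Finset.sum_mul, Finset.sum_div]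
    rw [hrec, hderiv.deriv, Finset.sum_neg_distrib, neg_neg]
    push_cast
    simp_rw [Finset.sum_div]
    rw [Finset.sum_comm]
    refine Finset.sum_congr rfl fun l hl => ?_
    rw [Finset.mem_Icc] at hl
    simp_rw [sub_div, ite_div, zero_div]
    rw [Finset.sum_sub_distrib, Finset.sum_ite_eq', Finset.sum_ite_eq',
      if_pos (Finset.mem_Icc.2 (by omega)), if_pos (Finset.mem_Icc.2 (by omega))]
end
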